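/- arXiv:2012.11518 — 2 statements merged into one kernel-verified Lean document; each statement's English description precedes it below -/
import Mathlib

section
/- Under the stochastic setting and the CGE definition, for every x ∈ ℝ^d the importance-sampled coordinate-wise gradient estimator satisfies E‖G_c(x) − ∇f(x)‖² ≤ Σ_{i=1}^d (1/p_i) [ 2 (∂_i f(x))² + (3/b_c)(ζ² + L² μ_{c,i}²/2) + L² μ_{c,i}²/2 ] − 2 ‖∇f(x)‖². -/
open MeasureTheory Finset
open scoped RealInnerProductSpace ENNReal

noncomputable section

/-- Euclidean space `ℝ^d`. -/
abbrev Euc (d : ℕ) := EuclideanSpace ℝ (Fin d)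

/-- `g : ℝ^d → ℝ` is `L`-smooth: differentiable with `L`-Lipschitz gradient. -/
def LSmooth {d : ℕ} (g : Euc d → ℝ) (L : ℝ) : Prop :=
  Differentiable ℝ g ∧ ∀ x y, ‖gradient g x - gradient g y‖ ≤ L * ‖x - y‖

/-- The uniform probability distribution on the unit sphere of `ℝ^d`, realized as the
pushforward of the normalized Lebesgue measure on the unit ball under radial projection. -/
def sphereUniform (d : ℕ) : Measure (Euc d) :=
  Measure.map (fun x => ‖x‖⁻¹ • x)
    ((volume (Metric.ball (0 : Euc d) 1))⁻¹ • volume.restrict (Metric.ball (0 : Euc d) 1))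

/-- Sample space measure for the RGE: `b_r` i.i.d. data samples from `P` together with
`b_r × n_r` i.i.d. uniform directions on the unit sphere, all independent. -/
def RGEmeas (d : ℕ) {Ω : Type} [MeasurableSpace Ω] (P : Measure Ω) (nr br : ℕ) :
    Measure ((Fin br → Ω) × (Fin br → Fin nr → Euc d)) :=
  (Measure.pi fun _ => P).prod (Measure.pi fun _ => Measure.pi fun _ => sphereUniform d)

/-- The random gradient estimator (RGE) at `x`, as a function of the sampled
data batch `ω.1` and sampled random directions `ω.2`. -/
def RGE {d : ℕ} {Ω : Type} (F : Euc d → Ω → ℝ) (μr : ℝ) (nr br : ℕ)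
    (x : Euc d) (ω : (Fin br → Ω) × (Fin br → Fin nr → Euc d)) : Euc d :=
  (br : ℝ)⁻¹ • ∑ j : Fin br, (nr : ℝ)⁻¹ • ∑ i : Fin nr,
    (((d : ℝ) / μr) * (F (x + μr • ω.2 j i) (ω.1 j) - F x (ω.1 j))) • ω.2 j i

/-- Bernoulli measure on `Bool` with success probability `p`. -/
def bern (p : ℝ) : Measure Bool :=
  ENNReal.ofReal p • Measure.dirac true + ENNReal.ofReal (1 - p) • Measure.dirac false

/-- Sample space measure for the CGE: independent Bernoulli coordinate-selection variables
`Z_i ~ Bern(p_i)` together with an independent i.i.d. data batch of size `b_c` from `P`. -/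
def CGEmeas (d : ℕ) {Ω : Type} [MeasurableSpace Ω] (P : Measure Ω) (bc : ℕ) (p : Fin d → ℝ) :
    Measure ((Fin d → Bool) × (Fin bc → Ω)) :=
  (Measure.pi fun i => bern (p i)).prod (Measure.pi fun _ => P)

/-- The importance-sampled coordinate-wise gradient estimator (CGE) at `x`, with
coordinate smoothing parameters `μc i`, selection probabilities `p i`, coordinate
indicators `ω.1` and data batch `ω.2`. -/
def CGE {d : ℕ} {Ω : Type} (F : Euc d → Ω → ℝ) (μc : Fin d → ℝ) (bc : ℕ) (p : Fin d → ℝ)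
    (x : Euc d) (ω : (Fin d → Bool) × (Fin bc → Ω)) : Euc d :=
  ∑ i : Fin d, (((if ω.1 i then (1:ℝ) else 0) / p i) * ((bc : ℝ)⁻¹ *
      ∑ j : Fin bc, (F (x + μc i • EuclideanSpace.single i (1:ℝ)) (ω.2 j)
        - F (x - μc i • EuclideanSpace.single i (1:ℝ)) (ω.2 j)) / (2 * μc i))) •
    EuclideanSpace.single i (1:ℝ)

/-- The symmetric difference quotient of `F(·, ω)` at `x` in the `i`-th coordinate direction. -/
def centralDiff {d : ℕ} {Ω : Type} (F : Euc d → Ω → ℝ) (h : ℝ) (i : Fin d) (x : Euc d)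
    (ω : Ω) : ℝ :=
  (F (x + h • EuclideanSpace.single i (1:ℝ)) ω
    - F (x - h • EuclideanSpace.single i (1:ℝ)) ω) / (2 * h)

theorem measurable_centralDiff {d : ℕ} {Ω : Type} [MeasurableSpace Ω] {F : Euc d → Ω → ℝ}
    (hF : Measurable (Function.uncurry F)) (h : ℝ) (i : Fin d) (x : Euc d) :
    Measurable (centralDiff F h i x) := by
  have hm (y : Euc d) : Measurable (F y) := hF.comp measurable_prodMk_left
  exact ((hm _).sub (hm _)).div_const _

/-- For an `L`-smooth function the symmetric difference quotient with step `h` approximates the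
partial derivative up to `L * h / 2`. -/
theorem LSmooth.abs_centralDiff_sub_le {d : ℕ} {Ω : Type} {F : Euc d → Ω → ℝ} {ω : Ω} {L : ℝ}
    (hg : LSmooth (fun y => F y ω) L) {h : ℝ} (hh : 0 < h) (i : Fin d) (x : Euc d) :
    |centralDiff F h i x ω - gradient (fun y => F y ω) x i| ≤ L * h / 2 := by
  set g : Euc d → ℝ := fun y => F y ω with hgdef
  set v : Euc d := EuclideanSpace.single i (1:ℝ) with hv
  have hvn : ‖v‖ = 1 := by simp [hv]
  have hderiv (c t : ℝ) :
      HasDerivAt (fun s : ℝ => g (x + (c * s) • v)) (c * gradient g (x + (c * t) • v) i) t := by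
    have h1 : HasDerivAt (fun s : ℝ => x + (c * s) • v) (c • v) t := by
      simpa using (((hasDerivAt_id t).const_mul c).smul_const v).const_add x
    have h2 := (hg.1 (x + (c * t) • v)).hasFDerivAt.comp_hasDerivAt t h1
    have h3 : fderiv ℝ g (x + (c * t) • v) (c • v) = c * gradient g (x + (c * t) • v) i := by
      rw [← inner_gradient_left, inner_smul_right, hv, EuclideanSpace.inner_single_right]
      simp
    exact h3 ▸ h2
  have hcoord (y : Euc d) : |gradient g y i - gradient g x i| ≤ L * ‖y - x‖ := by
    have := (PiLp.norm_apply_le (gradient g y - gradient g x) i).trans (hg.2 y x)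
    simpa using this
  have hφ (t : ℝ) : HasDerivAt
      (fun s : ℝ => g (x + (1 * s) • v) - g (x + (-1 * s) • v) - s * (2 * gradient g x i))
      (1 * gradient g (x + (1 * t) • v) i - -1 * gradient g (x + (-1 * t) • v) i
        - 1 * (2 * gradient g x i)) t :=
    ((hderiv 1 t).sub (hderiv (-1) t)).sub ((hasDerivAt_id t).mul_const _)
  have hB (t : ℝ) : HasDerivAt (fun s : ℝ => L * s ^ 2) (L * (2 * t)) t := by
    simpa using (hasDerivAt_pow 2 t).const_mul L
  have key := image_norm_le_of_norm_deriv_right_le_deriv_boundary (a := 0) (b := h)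
    (fun t _ => (hφ t).continuousAt.continuousWithinAt)
    (fun t _ => (hφ t).hasDerivWithinAt) (by simp) hB
    (by
      intro t ht
      have h1 := hcoord (x + (1 * t) • v)
      have h2 := hcoord (x + (-1 * t) • v)
      rw [add_sub_cancel_left, norm_smul, hvn, Real.norm_eq_abs, mul_one] at h1 h2
      rw [one_mul, abs_of_nonneg ht.1] at h1
      rw [neg_one_mul, abs_neg, abs_of_nonneg ht.1] at h2
      rw [Real.norm_eq_abs]
      rw [abs_le] at *
      simp only [one_mul, neg_one_mul] at *
      constructor <;> linarith [h1.1, h1.2, h2.1, h2.2])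
    (Set.right_mem_Icc.2 hh.le)
  have heq : centralDiff F h i x ω - gradient g x i
      = (g (x + (1 * h) • v) - g (x + (-1 * h) • v) - h * (2 * gradient g x i)) / (2 * h) := by
    simp only [centralDiff, hgdef, hv, one_mul, neg_one_mul, neg_smul, ← sub_eq_add_neg]
    field_simp
  rw [heq, abs_div, abs_of_pos (by positivity : 0 < 2 * h), div_le_iff₀ (by positivity)]
  rw [Real.norm_eq_abs] at key
  linarith

theorem aemeasurable_gradient_apply {d : ℕ} {Ω : Type} [MeasurableSpace Ω] {P : Measure Ω}
    {F : Euc d → Ω → ℝ} {L : ℝ} (hF : Measurable (Function.uncurry F))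
    (hsmooth : ∀ᵐ ω ∂P, LSmooth (fun x => F x ω) L) (i : Fin d) (x : Euc d) :
    AEMeasurable (fun ω => gradient (fun y => F y ω) x i) P := by
  refine aemeasurable_of_tendsto_metrizable_ae' (f := fun n : ℕ =>
    centralDiff F (1 / ((n : ℝ) + 1)) i x)
    (fun _ => (measurable_centralDiff hF _ i x).aemeasurable) ?_
  filter_upwards [hsmooth] with ω hω
  rw [tendsto_iff_norm_sub_tendsto_zero]
  have hlim : Filter.Tendsto (fun n : ℕ => L * (1 / ((n : ℝ) + 1)) / 2) Filter.atTop (nhds 0) := by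
    simpa using (tendsto_one_div_add_atTop_nhds_zero_nat.const_mul L).div_const 2
  exact squeeze_zero (fun _ => norm_nonneg _)
    (fun n => hω.abs_centralDiff_sub_le (by positivity) i x) hlim

/-- Almost every section of a square-integrable function on a product is square-integrable. -/
theorem ae_memLp_two_section {α β : Type*} [MeasurableSpace α] [MeasurableSpace β]
    {μ : Measure α} {ν : Measure β} [SFinite μ] [SFinite ν] {f : α × β → ℝ} (hf : Measurable f)
    (h : MemLp f 2 (μ.prod ν)) : ∀ᵐ a ∂μ, MemLp (fun b => f (a, b)) 2 ν := by
  filter_upwards [h.integrable_sq.prod_right_ae] with a ha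
  exact (memLp_two_iff_integrable_sq
    (hf.comp measurable_prodMk_left).aestronglyMeasurable).2 ha

/-- If a nonempty sum of independent copies of `D` is square-integrable, then so is `D`. -/
theorem memLp_two_of_memLp_two_sum_pi {Ω : Type*} [MeasurableSpace Ω] {P : Measure Ω}
    [IsProbabilityMeasure P] {D : Ω → ℝ} (hD : Measurable D) {n : ℕ} (hn : 1 ≤ n)
    (h : MemLp (fun ω : Fin n → Ω => ∑ j, D (ω j)) 2 (Measure.pi fun _ => P)) :
    MemLp D 2 P := by
  obtain ⟨m, rfl⟩ : ∃ m, n = m + 1 := ⟨n - 1, by omega⟩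
  have hmp := (measurePreserving_piFinSuccAbove (fun _ : Fin (m + 1) => P) 0).symm
  have h1 := h.comp_measurePreserving hmp
  have h2 := h1.comp_measurePreserving
    (Measure.measurePreserving_swap (μ := Measure.pi fun _ : Fin m => P) (ν := P))
  have hfun : MemLp (fun q : (Fin m → Ω) × Ω => D q.2 + ∑ j, D (q.1 j)) 2
      ((Measure.pi fun _ : Fin m => P).prod P) := by
    convert h2 using 1
    funext q
    simp [Fin.sum_univ_succ, MeasurableEquiv.piFinSuccAbove]
  obtain ⟨b, hb⟩ := (ae_memLp_two_section (by fun_prop) hfun).exists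
  convert hb.sub (memLp_const (∑ j, D (b j))) using 1
  funext ω
  simp

theorem isProbabilityMeasure_bern {p : ℝ} (h0 : 0 ≤ p) (h1 : p ≤ 1) :
    IsProbabilityMeasure (bern p) := by
  constructor
  simp [bern, ← ENNReal.ofReal_add h0 (sub_nonneg.2 h1)]

theorem integral_bern {p : ℝ} (h0 : 0 ≤ p) (h1 : p ≤ 1) (φ : Bool → ℝ) :
    ∫ b, φ b ∂(bern p) = p * φ true + (1 - p) * φ false := by
  unfold bern
  rw [integral_add_measure
    (Integrable.smul_measure (integrable_dirac (by simp)) ENNReal.ofReal_ne_top)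
    (Integrable.smul_measure (integrable_dirac (by simp)) ENNReal.ofReal_ne_top)]
  simp [integral_smul_measure, h0, h1]

theorem memLp_two_sum_pi {Ω : Type*} [MeasurableSpace Ω] {P : Measure Ω}
    [IsProbabilityMeasure P] {D : Ω → ℝ} (hD : MemLp D 2 P) (n : ℕ) :
    MemLp (fun ω : Fin n → Ω => (n : ℝ)⁻¹ * ∑ j, D (ω j)) 2 (Measure.pi fun _ => P) :=
  (memLp_finsetSum _ fun j _ =>
    hD.comp_measurePreserving (measurePreserving_eval (fun _ => P) j)).const_mul _

theorem integral_batch_mean {Ω : Type*} [MeasurableSpace Ω] {P : Measure Ω}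
    [IsProbabilityMeasure P] {D : Ω → ℝ} (hD : MemLp D 2 P) {n : ℕ} (hn : 1 ≤ n) :
    ∫ ω : Fin n → Ω, (n : ℝ)⁻¹ * ∑ j, D (ω j) ∂(Measure.pi fun _ => P) = ∫ ω, D ω ∂P := by
  have hn' : (n : ℝ) ≠ 0 := by positivity
  rw [integral_const_mul, integral_finsetSum]
  · simp_rw [integral_comp_eval (μ := fun _ : Fin n => P) hD.aestronglyMeasurable]
    simp [hn']
  · exact fun j _ => integrable_comp_eval (hD.integrable one_le_two)

theorem integral_batch_mean_sq {Ω : Type*} [MeasurableSpace Ω] {P : Measure Ω}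
    [IsProbabilityMeasure P] {D : Ω → ℝ} (hD : MemLp D 2 P) {n : ℕ} (hn : 1 ≤ n) :
    ∫ ω : Fin n → Ω, ((n : ℝ)⁻¹ * ∑ j, D (ω j)) ^ 2 ∂(Measure.pi fun _ => P)
      = (∫ ω, D ω ∂P) ^ 2 + ProbabilityTheory.variance D P / n := by
  have hn' : (n : ℝ) ≠ 0 := by positivity
  have h1 := ProbabilityTheory.variance_eq_sub (memLp_two_sum_pi hD n)
  have h2 := ProbabilityTheory.variance_sum_pi (μ := fun _ : Fin n => P) (X := fun _ => D)
    (fun _ => hD)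
  have h3 : (∑ j, fun ω : Fin n → Ω => D (ω j)) = fun ω => ∑ j, D (ω j) := by
    ext; simp
  rw [ProbabilityTheory.variance_const_mul, ← h3, h2, integral_batch_mean hD hn] at h1
  simp only [sum_const, card_univ, Fintype.card_fin, nsmul_eq_mul, Pi.pow_apply] at h1
  field_simp at h1 ⊢
  linarith

/-- Variance is bounded by the second moment about any point. -/
theorem variance_le_integral_sub_sq {Ω : Type*} [MeasurableSpace Ω] {P : Measure Ω}
    [IsProbabilityMeasure P] {D : Ω → ℝ} (hD : AEStronglyMeasurable D P) (c : ℝ) :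
    ProbabilityTheory.variance D P ≤ ∫ ω, (D ω - c) ^ 2 ∂P := by
  rw [← ProbabilityTheory.variance_sub_const hD c]
  exact ProbabilityTheory.variance_le_expectation_sq (hD.sub aestronglyMeasurable_const)

theorem importance_sampling_bound {p g m V W ε : ℝ} {n : ℕ} (hp0 : 0 < p) (hp1 : p ≤ 1)
    (hn : 1 ≤ n) (hm : (m - g) ^ 2 ≤ ε ^ 2) (hV : V ≤ W) :
    (1 / p) * (m ^ 2 + V / n) - 2 * g * m + g ^ 2
      ≤ (1 / p) * (2 * g ^ 2 + W / n + 2 * ε ^ 2) - 2 * g ^ 2 := by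
  have hn' : (0 : ℝ) < n := by positivity
  have h1 : V / n ≤ W / n := by gcongr
  have hq : 1 ≤ 1 / p := (one_le_div hp0).2 hp1
  have h2 : (1 / p) * (m ^ 2 + V / n) ≤ (1 / p) * (m ^ 2 + W / n + 2 * (ε ^ 2 - (m - g) ^ 2)) := by
    refine mul_le_mul_of_nonneg_left ?_ (by positivity)
    linarith
  have h3 : 0 ≤ (1 / p - 1) * (2 * g - m) ^ 2 := mul_nonneg (by linarith) (sq_nonneg _)
  nlinarith [sq_nonneg (m - g)]

theorem CGE_apply {d : ℕ} {Ω : Type} (F : Euc d → Ω → ℝ) (μc : Fin d → ℝ) (bc : ℕ)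
    (p : Fin d → ℝ) (x : Euc d) (ω : (Fin d → Bool) × (Fin bc → Ω)) (i : Fin d) :
    CGE F μc bc p x ω i = ((if ω.1 i then (1:ℝ) else 0) / p i) *
      ((bc : ℝ)⁻¹ * ∑ j, centralDiff F (μc i) i x (ω.2 j)) := by
  simp [CGE, centralDiff, Finset.sum_apply, Pi.single_apply]

/-- **Variance bound for the importance-sampled CGE (Proposition 2, eq. (8)).** -/
theorem cge_variance_bound
    (d : ℕ) (hd : 1 ≤ d)
    {Ω : Type} [MeasurableSpace Ω] (P : Measure Ω) [IsProbabilityMeasure P]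
    (L ζ : ℝ) (hL : 0 ≤ L) (hζ : 0 ≤ ζ)
    (F : Euc d → Ω → ℝ)
    (hFmeas : Measurable (Function.uncurry F))
    (hFsmooth : ∀ᵐ ω ∂P, LSmooth (fun x => F x ω) L)
    (f : Euc d → ℝ) (hfdef : ∀ x, f x = ∫ ω, F x ω ∂P)
    (hfsmooth : LSmooth f L)
    (hgradf : ∀ x, gradient f x = ∫ ω, gradient (fun y => F y ω) x ∂P)
    (hvar : ∀ (x : Euc d) (i : Fin d),
      ∫ ω, (gradient (fun y => F y ω) x i - gradient f x i) ^ 2 ∂P ≤ ζ ^ 2)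
    (μc : Fin d → ℝ) (hμc : ∀ i, 0 < μc i)
    (bc : ℕ) (hbc : 1 ≤ bc)
    (p : Fin d → ℝ) (hp : ∀ i, 0 < p i ∧ p i ≤ 1)
    (x : Euc d) :
    ∫ ω, ‖CGE F μc bc p x ω - gradient f x‖ ^ 2 ∂(CGEmeas d P bc p)
      ≤ (∑ i : Fin d, (1 / p i) * (2 * (gradient f x i) ^ 2
            + (3 / (bc : ℝ)) * (ζ ^ 2 + L ^ 2 * (μc i) ^ 2 / 2)
            + L ^ 2 * (μc i) ^ 2 / 2))
        - 2 * ‖gradient f x‖ ^ 2 := by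
  set g := gradient f x with hg
  set D : Fin d → Ω → ℝ := fun i => centralDiff F (μc i) i x with hD
  have hDmeas (i : Fin d) : Measurable (D i) := measurable_centralDiff hFmeas _ i x
  have hbern (i : Fin d) : IsProbabilityMeasure (bern (p i)) :=
    isProbabilityMeasure_bern (hp i).1.le (hp i).2
  set A : Fin d → (Fin bc → Ω) → ℝ := fun i ω => (bc : ℝ)⁻¹ * ∑ j, D i (ω j) with hA
  set Z : Fin d → (Fin d → Bool) → ℝ := fun i z => (if z i then (1:ℝ) else 0) / p i with hZ
  have hZmeas (i : Fin d) : Measurable (Z i) := measurable_of_finite _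
  have hAmeas (i : Fin d) : Measurable (A i) := by
    have := hDmeas i
    fun_prop
  have hnorm (ω : (Fin d → Bool) × (Fin bc → Ω)) :
      ‖CGE F μc bc p x ω - g‖ ^ 2 = ∑ i, (Z i ω.1 * A i ω.2 - g i) ^ 2 := by
    simp [EuclideanSpace.norm_sq_eq, CGE_apply, hZ, hA, hD]
  have hgnorm : ‖g‖ ^ 2 = ∑ i, g i ^ 2 := by
    simp [EuclideanSpace.norm_sq_eq]
  have hbc' : (0 : ℝ) < bc := by positivity
  rw [hgnorm, mul_sum, ← sum_sub_distrib]
  simp_rw [hnorm]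
  by_cases hint : Integrable (fun ω : (Fin d → Bool) × (Fin bc → Ω) =>
      ∑ i, (Z i ω.1 * A i ω.2 - g i) ^ 2) (CGEmeas d P bc p)
  swap
  · rw [integral_undef hint]
    refine sum_nonneg fun i _ => ?_
    have hq : 1 ≤ 1 / p i := (one_le_div (hp i).1).2 (hp i).2
    have h1 : 0 ≤ 3 / (bc : ℝ) * (ζ ^ 2 + L ^ 2 * μc i ^ 2 / 2) + L ^ 2 * μc i ^ 2 / 2 := by
      positivity
    nlinarith [mul_nonneg (sub_nonneg.2 hq) (sq_nonneg (g i)),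
      mul_nonneg (by linarith : 0 ≤ 1 / p i) h1]
  have hZint (i : Fin d) (φ : Bool → ℝ) : ∫ z, φ (z i) ∂(Measure.pi fun i => bern (p i))
      = p i * φ true + (1 - p i) * φ false := by
    rw [integral_comp_eval (μ := fun i => bern (p i)) (measurable_of_finite φ).aestronglyMeasurable,
      integral_bern (hp i).1.le (hp i).2]
  have hmeas (i : Fin d) : Measurable (fun ω : (Fin d → Bool) × (Fin bc → Ω) =>
      Z i ω.1 * A i ω.2 - g i) :=
    (((hZmeas i).comp measurable_fst).mul ((hAmeas i).comp measurable_snd)).sub_const _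
  have hDmem (i : Fin d) : MemLp (D i) 2 P := by
    have h1 : MemLp (fun ω : (Fin d → Bool) × (Fin bc → Ω) => Z i ω.1 * A i ω.2 - g i) 2
        (CGEmeas d P bc p) := by
      refine (memLp_two_iff_integrable_sq (hmeas i).aestronglyMeasurable).2 ?_
      refine hint.mono' ((hmeas i).pow_const 2).aestronglyMeasurable (ae_of_all _ fun ω => ?_)
      rw [Real.norm_of_nonneg (sq_nonneg _)]
      exact single_le_sum (f := fun i => (Z i ω.1 * A i ω.2 - g i) ^ 2)
        (fun _ _ => sq_nonneg _) (mem_univ i)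
    have h2 := ae_memLp_two_section (hmeas i) h1
    obtain ⟨z, hz, hzi⟩ : ∃ z : Fin d → Bool,
        MemLp (fun ω => Z i z * A i ω - g i) 2 (Measure.pi fun _ => P) ∧ z i = true := by
      by_contra! hcon
      have h3 := hZint i (fun b => if b then (1:ℝ) else 0)
      rw [integral_eq_zero_of_ae] at h3
      · simp [(hp i).1.ne] at h3
      · filter_upwards [h2] with z hz
        simp [hcon z hz]
    have hp0 := (hp i).1.ne'
    refine memLp_two_of_memLp_two_sum_pi (hDmeas i) hbc ?_
    convert (hz.add (memLp_const (g i))).const_mul (p i * bc) using 1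
    funext ω
    simp [hZ, hA, hzi]
    field_simp
  have hgradmeas (i : Fin d) := aemeasurable_gradient_apply hFmeas hFsmooth i x
  have hclose (i : Fin d) : ∀ᵐ ω ∂P,
      |D i ω - gradient (fun y => F y ω) x i| ≤ L * μc i / 2 := by
    filter_upwards [hFsmooth] with ω hω using hω.abs_centralDiff_sub_le (hμc i) i x
  have hdiffmem (i : Fin d) : MemLp (fun ω => D i ω - gradient (fun y => F y ω) x i) 2 P :=
    MemLp.of_bound ((hDmeas i).aemeasurable.sub (hgradmeas i)).aestronglyMeasurable _ (hclose i)
  have hgradmem (i : Fin d) : MemLp (fun ω => gradient (fun y => F y ω) x i) 2 P := by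
    convert (hDmem i).sub (hdiffmem i) using 1
    funext ω
    simp
  have hgi (i : Fin d) : g i = ∫ ω, gradient (fun y => F y ω) x i ∂P := by
    rw [hg, hgradf x]
    exact eval_integral_piLp (fun i => (hgradmem i).integrable one_le_two) i
  have hbias (i : Fin d) : (∫ ω, D i ω ∂P - g i) ^ 2 ≤ (L * μc i / 2) ^ 2 := by
    rw [hgi i, ← integral_sub ((hDmem i).integrable one_le_two)
      ((hgradmem i).integrable one_le_two)]
    have := norm_integral_le_of_norm_le_const
      (f := fun ω => D i ω - gradient (fun y => F y ω) x i) (hclose i)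
    simp only [probReal_univ, mul_one, Real.norm_eq_abs] at this
    exact sq_le_sq' (abs_le.1 this).1 (abs_le.1 this).2
  have hvarD (i : Fin d) : ProbabilityTheory.variance (D i) P
      ≤ 3 * (ζ ^ 2 + L ^ 2 * μc i ^ 2 / 2) := by
    have hsq : Integrable (fun ω => (gradient (fun y => F y ω) x i - g i) ^ 2) P :=
      ((hgradmem i).sub (memLp_const (g i))).integrable_sq
    have h1 : ∫ ω, (D i ω - g i) ^ 2 ∂P
        ≤ ∫ ω, (2 * (gradient (fun y => F y ω) x i - g i) ^ 2 + 2 * (L * μc i / 2) ^ 2) ∂P := by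
      refine integral_mono_ae ((hDmem i).sub (memLp_const (g i))).integrable_sq
        ((hsq.const_mul 2).add (integrable_const _)) ?_
      filter_upwards [hclose i] with ω hω
      have h2 := sq_le_sq' (abs_le.1 hω).1 (abs_le.1 hω).2
      nlinarith [sq_nonneg ((gradient (fun y => F y ω) x i - g i)
        - (D i ω - gradient (fun y => F y ω) x i))]
    rw [integral_add (hsq.const_mul 2) (integrable_const _), integral_const_mul,
      integral_const] at h1
    simp only [probReal_univ, one_smul] at h1
    have h3 := variance_le_integral_sub_sq (P := P) (hDmeas i).aestronglyMeasurable (g i)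
    nlinarith [hvar x i, sq_nonneg ζ, sq_nonneg (L * μc i)]
  have hterm (i : Fin d) :
      Integrable (fun ω : (Fin d → Bool) × (Fin bc → Ω) => (Z i ω.1 * A i ω.2 - g i) ^ 2)
        (CGEmeas d P bc p) ∧
      ∫ ω, (Z i ω.1 * A i ω.2 - g i) ^ 2 ∂(CGEmeas d P bc p)
        = (1 / p i) * ((∫ ω, D i ω ∂P) ^ 2 + ProbabilityTheory.variance (D i) P / bc)
          - 2 * g i * (∫ ω, D i ω ∂P) + g i ^ 2 := by
    have hp0 := (hp i).1.ne'
    have hAmem : MemLp (A i) 2 (Measure.pi fun _ => P) := memLp_two_sum_pi (hDmem i) bc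
    have hZ1 : ∫ z, Z i z ∂(Measure.pi fun i => bern (p i)) = 1 := by
      rw [hZint i (fun b => (if b then (1:ℝ) else 0) / p i)]
      simp [hp0]
    have hZ2 : ∫ z, Z i z ^ 2 ∂(Measure.pi fun i => bern (p i)) = 1 / p i := by
      rw [hZint i (fun b => ((if b then (1:ℝ) else 0) / p i) ^ 2)]
      simp
      field_simp
    have hI1 : Integrable (fun ω : (Fin d → Bool) × (Fin bc → Ω) => Z i ω.1 * A i ω.2)
        (CGEmeas d P bc p) :=
      Integrable.mul_prod (.of_finite) (hAmem.integrable one_le_two)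
    have hI2 : Integrable (fun ω : (Fin d → Bool) × (Fin bc → Ω) => Z i ω.1 ^ 2 * A i ω.2 ^ 2)
        (CGEmeas d P bc p) :=
      Integrable.mul_prod (f := fun z => Z i z ^ 2) (.of_finite) hAmem.integrable_sq
    have hprob : IsProbabilityMeasure (CGEmeas d P bc p) := by
      unfold CGEmeas
      infer_instance
    have hexp : (fun ω : (Fin d → Bool) × (Fin bc → Ω) => (Z i ω.1 * A i ω.2 - g i) ^ 2)
        = fun ω => Z i ω.1 ^ 2 * A i ω.2 ^ 2 - 2 * g i * (Z i ω.1 * A i ω.2) + g i ^ 2 := by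
      funext ω
      ring
    rw [hexp]
    have hI3 : Integrable (fun ω : (Fin d → Bool) × (Fin bc → Ω) =>
        Z i ω.1 ^ 2 * A i ω.2 ^ 2 - 2 * g i * (Z i ω.1 * A i ω.2)) (CGEmeas d P bc p) :=
      hI2.sub (hI1.const_mul (2 * g i))
    refine ⟨hI3.add (integrable_const _), ?_⟩
    rw [integral_add hI3 (integrable_const _), integral_sub hI2 (hI1.const_mul _),
      integral_const_mul, integral_const]
    unfold CGEmeas
    rw [integral_prod_mul (fun z => Z i z ^ 2) (fun ω => A i ω ^ 2), integral_prod_mul, hZ1, hZ2,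
      integral_batch_mean (hDmem i) hbc, integral_batch_mean_sq (hDmem i) hbc]
    simp
  rw [integral_finsetSum _ fun i _ => (hterm i).1]
  refine sum_le_sum fun i _ => ?_
  rw [(hterm i).2]
  refine (importance_sampling_bound (hp i).1 (hp i).2 hbc (hbias i) (hvarD i)).trans_eq ?_
  ring
end
end

section
/- Under the stochastic setting and the RGE definition, for every x ∈ ℝ^d: E‖G_r(x)‖² ≤ (2 + (4/b_r)(1 + d/n_r)) ‖∇f(x)‖² + (4σ²/b_r)(1 + d/n_r) + (1 + 2/b_r + 2/(n_r b_r)) μ_r² L² d² / 2. -/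
open MeasureTheory Finset
open scoped RealInnerProductSpace ENNReal

noncomputable section

lemma integral_sq_sum_pi {ι : Type*} [Fintype ι] {X : ι → Type*} [∀ k, MeasurableSpace (X k)]
    {μ : ∀ k, Measure (X k)} [∀ k, IsProbabilityMeasure (μ k)] {T : ∀ k, X k → ℝ}
    (h : ∀ k, MemLp (T k) 2 (μ k)) :
    ∫ ω, (∑ k, T k (ω k)) ^ 2 ∂(Measure.pi μ)
      = (∑ k, ∫ y, T k y ∂(μ k)) ^ 2
        + ∑ k, (∫ y, T k y ^ 2 ∂(μ k) - (∫ y, T k y ∂(μ k)) ^ 2) := by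
  have hk : ∀ k, MemLp (fun ω : ∀ k, X k => T k (ω k)) 2 (Measure.pi μ) := fun k =>
    (h k).comp_measurePreserving (measurePreserving_eval μ k)
  have hsum : MemLp (∑ k, fun ω : ∀ k, X k => T k (ω k)) 2 (Measure.pi μ) :=
    memLp_finsetSum' _ fun k _ => hk k
  have hvar := ProbabilityTheory.variance_sum_pi h
  rw [ProbabilityTheory.variance_eq_sub hsum,
    Finset.sum_congr rfl fun k _ => ProbabilityTheory.variance_eq_sub (h k)] at hvar
  have hmean : ∫ ω, (∑ k, fun ω : ∀ k, X k => T k (ω k)) ω ∂(Measure.pi μ)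
      = ∑ k, ∫ y, T k y ∂(μ k) := by
    simp only [Finset.sum_apply]
    rw [integral_finsetSum _ fun k _ => (hk k).integrable (by norm_num)]
    exact Finset.sum_congr rfl fun k _ => integral_comp_eval (h k).1
  rw [hmean] at hvar
  simp only [Pi.pow_apply, Finset.sum_apply] at hvar
  linarith

lemma MeasureTheory.MemLp.euc_apply {d : ℕ} {α : Type*} [MeasurableSpace α] {μ : Measure α}
    {T : α → Euc d} {p : ℝ≥0∞} (h : MemLp T p μ) (c : Fin d) : MemLp (fun y => T y c) p μ :=
  (EuclideanSpace.proj (𝕜 := ℝ) c).comp_memLp' h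

lemma integral_euc_apply {d : ℕ} {α : Type*} [MeasurableSpace α] {μ : Measure α}
    {T : α → Euc d} (h : Integrable T μ) (c : Fin d) : (∫ y, T y ∂μ) c = ∫ y, T y c ∂μ :=
  ((EuclideanSpace.proj (𝕜 := ℝ) c).integral_comp_comm h).symm

lemma integral_norm_sq_eq_sum {d : ℕ} {α : Type*} [MeasurableSpace α] {μ : Measure α}
    {T : α → Euc d} (h : MemLp T 2 μ) : ∫ y, ‖T y‖ ^ 2 ∂μ = ∑ c, ∫ y, T y c ^ 2 ∂μ := by
  simp only [EuclideanSpace.real_norm_sq_eq]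
  exact integral_finsetSum _ fun c _ => (h.euc_apply c).integrable_sq

/-- Second moment of a sum of independent random vectors. -/
lemma integral_norm_sq_sum_pi {d : ℕ} {ι : Type*} [Fintype ι] {X : ι → Type*}
    [∀ k, MeasurableSpace (X k)] {μ : ∀ k, Measure (X k)} [∀ k, IsProbabilityMeasure (μ k)]
    {T : ∀ k, X k → Euc d} (h : ∀ k, MemLp (T k) 2 (μ k)) :
    ∫ ω, ‖∑ k, T k (ω k)‖ ^ 2 ∂(Measure.pi μ)
      = ‖∑ k, ∫ y, T k y ∂(μ k)‖ ^ 2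
        + ∑ k, (∫ y, ‖T k y‖ ^ 2 ∂(μ k) - ‖∫ y, T k y ∂(μ k)‖ ^ 2) := by
  have hsum : MemLp (fun ω : ∀ k, X k => ∑ k, T k (ω k)) 2 (Measure.pi μ) :=
    memLp_finsetSum _ fun k _ => (h k).comp_measurePreserving (measurePreserving_eval μ k)
  have hc : ∀ c, ∫ ω, (∑ k, T k (ω k)) c ^ 2 ∂(Measure.pi μ) = _ := fun c => by
    simpa only [WithLp.ofLp_sum, Finset.sum_apply] using
      integral_sq_sum_pi fun k => (h k).euc_apply c
  rw [integral_norm_sq_eq_sum hsum, Finset.sum_congr rfl fun c _ => hc c, Finset.sum_add_distrib]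
  congr 1
  · rw [EuclideanSpace.real_norm_sq_eq]
    simp [integral_euc_apply ((h _).integrable (by norm_num : (1 : ℝ≥0∞) ≤ 2))]
  · rw [Finset.sum_comm]
    refine Finset.sum_congr rfl fun k _ => ?_
    rw [integral_norm_sq_eq_sum (h k), EuclideanSpace.real_norm_sq_eq, Finset.sum_sub_distrib]
    simp [integral_euc_apply ((h k).integrable (by norm_num : (1 : ℝ≥0∞) ≤ 2))]

/-- A sum of i.i.d. random vectors is square integrable only if each summand is. -/
lemma memLp_of_memLp_sum_pi {E α : Type*} [NormedAddCommGroup E] [MeasurableSpace α]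
    {P : Measure α} [IsProbabilityMeasure P] {n : ℕ} (hn : 1 ≤ n) {p : ℝ≥0∞} (hp : p ≠ 0)
    (hp' : p ≠ ∞) {g : α → E}
    (h : MemLp (fun ω : Fin n → α => ∑ j, g (ω j)) p (Measure.pi fun _ => P)) : MemLp g p P := by
  obtain ⟨m, rfl⟩ : ∃ m, n = m + 1 := ⟨n - 1, by omega⟩
  have h1 := h.comp_measurePreserving
    (measurePreserving_piFinSuccAbove (fun _ : Fin (m + 1) => P) 0).symm
  have h2 : ∀ᵐ y ∂(Measure.pi fun _ : Fin m => P), MemLp (fun x => g x + ∑ j, g (y j)) p P := by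
    filter_upwards [((integrable_norm_rpow_iff h1.1 hp hp').2 h1).prod_left_ae,
      h1.1.prodMk_right] with y hy hy'
    have := (integrable_norm_rpow_iff hy' hp hp').1 hy
    simpa [Function.comp_def, Fin.sum_univ_succ] using this
  obtain ⟨y, hy⟩ := h2.exists
  convert! hy.sub (memLp_const (∑ j, g (y j))) using 1
  ext1 z
  simp
lemma LSmooth.abs_sub_inner_le {d : ℕ} {g : Euc d → ℝ} {L : ℝ} (hg : LSmooth g L)
    (x h : Euc d) : |g (x + h) - g x - ⟪gradient g x, h⟫| ≤ L * ‖h‖ ^ 2 / 2 := by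
  have hd : ∀ t : ℝ, HasDerivAt (fun t : ℝ => g (x + t • h) - g x - t * ⟪gradient g x, h⟫)
      (⟪gradient g (x + t • h), h⟫ - ⟪gradient g x, h⟫) t := fun t => by
    have h1 : HasDerivAt (fun t : ℝ => x + t • h) h t := by
      simpa using ((hasDerivAt_id t).smul_const h).const_add x
    have h2 := (hg.1 (x + t • h)).hasGradientAt.hasFDerivAt.comp_hasDerivAt t h1
    have h3 := (h2.sub_const (g x)).sub ((hasDerivAt_id t).mul_const ⟪gradient g x, h⟫)
    convert! h3 using 1
    simp
  have hB : ∀ t : ℝ, HasDerivAt (fun t : ℝ => L * ‖h‖ ^ 2 / 2 * t ^ 2) (L * ‖h‖ ^ 2 * t) t :=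
    fun t => by
      convert! (hasDerivAt_pow 2 t).const_mul (L * ‖h‖ ^ 2 / 2) using 1
      push_cast; ring
  have := image_norm_le_of_norm_deriv_right_le_deriv_boundary (a := 0) (b := 1)
    (fun t _ => (hd t).continuousAt.continuousWithinAt)
    (fun t _ => (hd t).hasDerivWithinAt) (by simp) hB
    (fun t ht => by
      rw [← inner_sub_left]
      refine (norm_inner_le_norm _ _).trans ?_
      have := hg.2 (x + t • h) x
      rw [add_sub_cancel_left, norm_smul, Real.norm_of_nonneg ht.1] at this
      nlinarith [norm_nonneg h]) (Set.right_mem_Icc.2 zero_le_one)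
  simpa using this

instance isProbabilityMeasure_sphereUniform (d : ℕ) : IsProbabilityMeasure (sphereUniform d) := by
  have h0 : volume (Metric.ball (0 : Euc d) 1) ≠ 0 :=
    (Metric.measure_ball_pos volume 0 one_pos).ne'
  have h1 : volume (Metric.ball (0 : Euc d) 1) ≠ ∞ := measure_ball_lt_top.ne
  have : IsProbabilityMeasure ((volume (Metric.ball (0 : Euc d) 1))⁻¹ •
      volume.restrict (Metric.ball (0 : Euc d) 1)) :=
    ⟨by simp [ENNReal.inv_mul_cancel h0 h1]⟩
  exact Measure.isProbabilityMeasure_map (by fun_prop)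

lemma ae_norm_eq_one_sphereUniform {d : ℕ} (hd : 1 ≤ d) : ∀ᵐ u ∂(sphereUniform d), ‖u‖ = 1 := by
  have : NeZero d := ⟨by omega⟩
  rw [sphereUniform, ae_map_iff (by fun_prop) (measurableSet_eq_fun (by fun_prop) (by fun_prop))]
  refine Measure.ae_smul_measure (ae_restrict_of_ae ?_) _
  filter_upwards [Measure.ae_ne volume (0 : Euc d)] with x hx
  simp [norm_smul, norm_ne_zero_iff.2 hx]

/-- The uniform distribution on the sphere is invariant under linear isometries. -/
lemma measurePreserving_sphereUniform {d : ℕ} (e : Euc d ≃ₗᵢ[ℝ] Euc d) :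
    MeasurePreserving e (sphereUniform d) (sphereUniform d) := by
  refine ⟨e.continuous.measurable, ?_⟩
  have hr : Measurable fun x : Euc d => ‖x‖⁻¹ • x := by fun_prop
  have hball := (e.measurePreserving.restrict_preimage
    (Metric.isOpen_ball (x := (0 : Euc d)) (ε := 1)).measurableSet)
  rw [LinearIsometryEquiv.preimage_ball, map_zero] at hball
  have hcomm : e ∘ (fun x : Euc d => ‖x‖⁻¹ • x) = (fun x : Euc d => ‖x‖⁻¹ • x) ∘ e := by
    ext1 x; simp
  rw [sphereUniform, Measure.map_map e.continuous.measurable hr, hcomm,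
    ← Measure.map_map hr e.continuous.measurable, Measure.map_smul, hball.map_eq]

lemma memLp_top_id_sphereUniform {d : ℕ} (hd : 1 ≤ d) :
    MemLp (fun u : Euc d => u) ∞ (sphereUniform d) :=
  memLp_top_of_bound (by fun_prop) 1 ((ae_norm_eq_one_sphereUniform hd).mono fun _ hu => hu.le)

lemma integrable_inner_mul_inner_sphereUniform {d : ℕ} (hd : 1 ≤ d) (v w : Euc d) :
    Integrable (fun u => ⟪v, u⟫ * ⟪w, u⟫) (sphereUniform d) := by
  refine Integrable.of_bound (by fun_prop) (‖v‖ * ‖w‖) ?_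
  filter_upwards [ae_norm_eq_one_sphereUniform hd] with u hu
  have h1 := norm_inner_le_norm (𝕜 := ℝ) v u
  have h2 := norm_inner_le_norm (𝕜 := ℝ) w u
  rw [hu, mul_one] at h1 h2
  rw [norm_mul]
  gcongr

lemma integral_inner_sq_sphereUniform {d : ℕ} (hd : 1 ≤ d) (v : Euc d) :
    ∫ u, ⟪v, u⟫ ^ 2 ∂(sphereUniform d) = ‖v‖ ^ 2 / d := by
  have hrot : ∀ v w : Euc d, ‖v‖ = ‖w‖ →
      ∫ u, ⟪v, u⟫ ^ 2 ∂(sphereUniform d) = ∫ u, ⟪w, u⟫ ^ 2 ∂(sphereUniform d) := fun v w h => by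
    set e := (ℝ ∙ (v - w))ᗮ.reflection
    have he : e v = w := Submodule.reflection_sub h
    rw [← (measurePreserving_sphereUniform e).integral_comp e.toHomeomorph.measurableEmbedding
      (fun u => ⟪w, u⟫ ^ 2), ← he]
    simp [e.inner_map_map]
  have hscale : ∀ i : Fin d, ∫ u, ⟪v, u⟫ ^ 2 ∂(sphereUniform d)
      = ‖v‖ ^ 2 * ∫ u : Euc d, u i ^ 2 ∂(sphereUniform d) := fun i => by
    rw [hrot v (‖v‖ • EuclideanSpace.single i 1) (by simp [norm_smul]), ← integral_const_mul]
    congr 1 with u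
    simp [inner_smul_left, mul_pow, EuclideanSpace.inner_single_left]
  have htotal : ∑ i : Fin d, ∫ u : Euc d, u i ^ 2 ∂(sphereUniform d) = 1 := by
    rw [← integral_norm_sq_eq_sum ((memLp_top_id_sphereUniform hd).mono_exponent le_top),
      integral_congr_ae (g := fun _ => (1 : ℝ))
        ((ae_norm_eq_one_sphereUniform hd).mono fun u hu => by simp [hu])]
    simp
  have hd' : (d : ℝ) ≠ 0 := by positivity
  have := Finset.sum_congr rfl fun i (_ : i ∈ Finset.univ) => hscale i
  rw [← Finset.mul_sum, htotal, Finset.sum_const, Finset.card_univ, Fintype.card_fin,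
    nsmul_eq_mul, mul_one] at this
  field_simp
  linarith

lemma integral_inner_mul_inner_sphereUniform {d : ℕ} (hd : 1 ≤ d) (v w : Euc d) :
    ∫ u, ⟪v, u⟫ * ⟪w, u⟫ ∂(sphereUniform d) = ⟪v, w⟫ / d := by
  have hint : ∀ z : Euc d, Integrable (fun u => ⟪z, u⟫ ^ 2) (sphereUniform d) := fun z => by
    simpa [sq] using integrable_inner_mul_inner_sphereUniform hd z z
  have hpol : ∀ u : Euc d, ⟪v, u⟫ * ⟪w, u⟫ = 4⁻¹ * (⟪v + w, u⟫ ^ 2 - ⟪v - w, u⟫ ^ 2) :=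
    fun u => by rw [inner_add_left, inner_sub_left]; ring
  simp_rw [hpol]
  rw [integral_const_mul, integral_sub (hint _) (hint _), integral_inner_sq_sphereUniform hd,
    integral_inner_sq_sphereUniform hd, norm_add_sq_real, norm_sub_sq_real]
  ring

lemma memLp_inner_smul_sphereUniform {d : ℕ} (hd : 1 ≤ d) (v : Euc d) :
    MemLp (fun u : Euc d => ((d : ℝ) * ⟪v, u⟫) • u) 2 (sphereUniform d) := by
  refine MemLp.of_bound (by fun_prop) ((d : ℝ) * ‖v‖) ?_
  filter_upwards [ae_norm_eq_one_sphereUniform hd] with u hu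
  have h1 := norm_inner_le_norm (𝕜 := ℝ) v u
  rw [hu, mul_one] at h1
  rw [norm_smul, norm_mul, hu, mul_one, Real.norm_natCast]
  gcongr

lemma integral_inner_smul_sphereUniform {d : ℕ} (hd : 1 ≤ d) (v : Euc d) :
    ∫ u : Euc d, ((d : ℝ) * ⟪v, u⟫) • u ∂(sphereUniform d) = v := by
  have hd' : (d : ℝ) ≠ 0 := by positivity
  ext c
  rw [integral_euc_apply ((memLp_inner_smul_sphereUniform hd v).integrable (by norm_num))]
  have h := integral_inner_mul_inner_sphereUniform hd v (EuclideanSpace.single c 1)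
  simp only [EuclideanSpace.inner_single_left, EuclideanSpace.inner_single_right] at h
  simp only [PiLp.smul_apply, smul_eq_mul, mul_assoc, integral_const_mul]
  simp only [map_one, one_mul] at h
  rw [h]
  simp; field_simp

lemma integral_norm_sq_inner_smul_sphereUniform {d : ℕ} (hd : 1 ≤ d) (v : Euc d) :
    ∫ u : Euc d, ‖((d : ℝ) * ⟪v, u⟫) • u‖ ^ 2 ∂(sphereUniform d) = d * ‖v‖ ^ 2 := by
  have hd' : (d : ℝ) ≠ 0 := by positivity
  rw [integral_congr_ae (g := fun u => (d : ℝ) ^ 2 * ⟪v, u⟫ ^ 2), integral_const_mul,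
    integral_inner_sq_sphereUniform hd]
  · field_simp
  · filter_upwards [ae_norm_eq_one_sphereUniform hd] with u hu
    simp [norm_smul, hu, mul_pow]

lemma aemeasurable_gradient_of_measurable {d : ℕ} {Ω : Type*} [MeasurableSpace Ω]
    {P : Measure Ω} {F : Euc d → Ω → ℝ} (hF : ∀ y, Measurable (F y)) {x : Euc d}
    (hdiff : ∀ᵐ ω ∂P, DifferentiableAt ℝ (fun y => F y ω) x) :
    AEMeasurable (fun ω => gradient (fun y => F y ω) x) P := by
  have hcoord : ∀ c, AEMeasurable (fun ω => gradient (fun y => F y ω) x c) P := fun c => by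
    refine aemeasurable_of_tendsto_metrizable_ae (u := Filter.atTop)
      (f := fun (n : ℕ) ω =>
        (n : ℝ) • (F (x + (n : ℝ)⁻¹ • EuclideanSpace.single c 1) ω - F x ω))
      (fun n => Measurable.aemeasurable (((hF _).sub (hF _)).const_smul (n : ℝ))) ?_
    filter_upwards [hdiff] with ω hω
    have := (hω.hasGradientAt.hasFDerivAt.lim_real (EuclideanSpace.single c 1)).comp
      tendsto_natCast_atTop_atTop
    rw [InnerProductSpace.toDual_apply_apply, EuclideanSpace.inner_single_right] at this
    simpa [Function.comp_def] using this
  exact (WithLp.measurable_toLp 2 _).comp_aemeasurable (aemeasurable_pi_iff.2 hcoord)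

/-- The linear part of the random gradient estimator: the finite difference along each direction
is replaced by the directional derivative, where `v j` is the gradient of the `j`-th sample. -/
def linearRGE {d : ℕ} {nr br : ℕ} (v : Fin br → Euc d) (w : Fin br → Fin nr → Euc d) : Euc d :=
  (br : ℝ)⁻¹ • ∑ j, (nr : ℝ)⁻¹ • ∑ i, ((d : ℝ) * ⟪v j, w j i⟫) • w j i

section linearRGE

variable {d : ℕ} {nr : ℕ}

lemma memLp_inner_smul_eval (hd : 1 ≤ d) (v : Euc d) (i : Fin nr) :
    MemLp (fun w : Fin nr → Euc d => ((d : ℝ) * ⟪v, w i⟫) • w i) 2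
      (Measure.pi fun _ => sphereUniform d) :=
  (memLp_inner_smul_sphereUniform hd v).comp_measurePreserving
    (measurePreserving_eval (fun _ : Fin nr => sphereUniform d) i)

lemma memLp_average_inner_smul (hd : 1 ≤ d) (v : Euc d) :
    MemLp (fun w : Fin nr → Euc d => (nr : ℝ)⁻¹ • ∑ i, ((d : ℝ) * ⟪v, w i⟫) • w i) 2
      (Measure.pi fun _ => sphereUniform d) :=
  (memLp_finsetSum Finset.univ fun i _ => memLp_inner_smul_eval hd v i).const_smul (nr : ℝ)⁻¹

lemma integral_average_inner_smul (hd : 1 ≤ d) (hnr : 1 ≤ nr) (v : Euc d) :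
    ∫ w : Fin nr → Euc d, (nr : ℝ)⁻¹ • ∑ i, ((d : ℝ) * ⟪v, w i⟫) • w i
      ∂(Measure.pi fun _ => sphereUniform d) = v := by
  have hnr' : (nr : ℝ) ≠ 0 := by positivity
  have hT := memLp_inner_smul_sphereUniform hd v
  rw [integral_smul, integral_finsetSum _ fun i _ =>
    (memLp_inner_smul_eval hd v i).integrable (by norm_num)]
  rw [Finset.sum_congr rfl fun i _ => (integral_comp_eval
    (μ := fun _ : Fin nr => sphereUniform d) (i := i) hT.1).trans
      (integral_inner_smul_sphereUniform hd v)]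
  rw [Finset.sum_const, Finset.card_univ, Fintype.card_fin, ← Nat.cast_smul_eq_nsmul ℝ, smul_smul,
    inv_mul_cancel₀ hnr', one_smul]

lemma integral_norm_sq_average_inner_smul (hd : 1 ≤ d) (hnr : 1 ≤ nr) (v : Euc d) :
    ∫ w : Fin nr → Euc d, ‖(nr : ℝ)⁻¹ • ∑ i, ((d : ℝ) * ⟪v, w i⟫) • w i‖ ^ 2
      ∂(Measure.pi fun _ => sphereUniform d) = ‖v‖ ^ 2 + (d - 1) / nr * ‖v‖ ^ 2 := by
  have hnr' : (nr : ℝ) ≠ 0 := by positivity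
  simp_rw [norm_smul _ (∑ i, _), mul_pow]
  rw [integral_const_mul, integral_norm_sq_sum_pi (μ := fun _ : Fin nr => sphereUniform d)
    (T := fun _ u => ((d : ℝ) * ⟪v, u⟫) • u) fun _ => memLp_inner_smul_sphereUniform hd v]
  simp_rw [integral_inner_smul_sphereUniform hd, integral_norm_sq_inner_smul_sphereUniform hd]
  rw [Finset.sum_const, Finset.sum_const, Finset.card_univ, Fintype.card_fin,
    ← Nat.cast_smul_eq_nsmul ℝ, norm_smul]
  simp only [norm_inv, Real.norm_natCast, nsmul_eq_mul]
  field_simp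

lemma integral_norm_sq_linearRGE (hd : 1 ≤ d) (hnr : 1 ≤ nr) {br : ℕ} (v : Fin br → Euc d) :
    ∫ w : Fin br → Fin nr → Euc d, ‖linearRGE v w‖ ^ 2
      ∂(Measure.pi fun _ => Measure.pi fun _ => sphereUniform d)
      = ((br : ℝ)⁻¹) ^ 2 * (‖∑ j, v j‖ ^ 2 + (d - 1) / nr * ∑ j, ‖v j‖ ^ 2) := by
  simp_rw [linearRGE, norm_smul _ (∑ j, (nr : ℝ)⁻¹ • _), mul_pow]
  rw [integral_const_mul, integral_norm_sq_sum_pi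
    (μ := fun _ : Fin br => Measure.pi fun _ : Fin nr => sphereUniform d)
    (T := fun j w => (nr : ℝ)⁻¹ • ∑ i, ((d : ℝ) * ⟪v j, w i⟫) • w i)
    fun j => memLp_average_inner_smul hd (v j)]
  simp_rw [integral_average_inner_smul hd hnr, integral_norm_sq_average_inner_smul hd hnr,
    Finset.mul_sum]
  simp

end linearRGE

lemma norm_finiteDifference_sub_le {d : ℕ} {φ : Euc d → ℝ} {L μr : ℝ} (hμr : 0 < μr)
    (hφ : LSmooth φ L) (x : Euc d) {u : Euc d} (hu : ‖u‖ = 1) :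
    ‖(((d : ℝ) / μr) * (φ (x + μr • u) - φ x)) • u - ((d : ℝ) * ⟪gradient φ x, u⟫) • u‖
      ≤ d * L * μr / 2 := by
  have h := hφ.abs_sub_inner_le x (μr • u)
  rw [inner_smul_right, norm_smul, hu, mul_one, Real.norm_eq_abs, sq_abs] at h
  have hfac : (d : ℝ) / μr * (φ (x + μr • u) - φ x) - d * ⟪gradient φ x, u⟫
      = d / μr * (φ (x + μr • u) - φ x - μr * ⟪gradient φ x, u⟫) := by
    field_simp
  rw [← sub_smul, norm_smul, hu, mul_one, hfac, norm_mul, Real.norm_eq_abs, Real.norm_eq_abs,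
    abs_of_nonneg (by positivity)]
  calc _ ≤ (d : ℝ) / μr * (L * μr ^ 2 / 2) := by gcongr
    _ = _ := by field_simp

lemma norm_average_sub_average_le {E : Type*} [SeminormedAddCommGroup E] [NormedSpace ℝ E] {n : ℕ}
    (hn : 1 ≤ n) {a b : Fin n → E} {C : ℝ} (h : ∀ i, ‖a i - b i‖ ≤ C) :
    ‖(n : ℝ)⁻¹ • ∑ i, a i - (n : ℝ)⁻¹ • ∑ i, b i‖ ≤ C := by
  have hn' : (0 : ℝ) < n := by positivity
  rw [← smul_sub, ← Finset.sum_sub_distrib, norm_smul, norm_inv, Real.norm_natCast,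
    inv_mul_le_iff₀ hn']
  simpa using norm_sum_le_of_le Finset.univ fun i _ => h i

lemma norm_sq_le_of_norm_sub_le {E : Type*} [SeminormedAddCommGroup E] {a b : E} {C : ℝ}
    (h : ‖a - b‖ ≤ C) : ‖a‖ ^ 2 ≤ 2 * ‖b‖ ^ 2 + 2 * C ^ 2 := by
  have h1 : ‖a‖ ≤ ‖b‖ + C := (norm_le_norm_add_norm_sub b a).trans (by
    rw [norm_sub_rev]; gcongr)
  nlinarith [norm_nonneg a, norm_nonneg b, sq_nonneg (‖b‖ - C)]

lemma norm_RGE_sub_linearRGE_le {d : ℕ} {Ω : Type} {F : Euc d → Ω → ℝ} {L μr : ℝ} (hμr : 0 < μr)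
    {nr br : ℕ} (hnr : 1 ≤ nr) (hbr : 1 ≤ br) (x : Euc d)
    {ω : (Fin br → Ω) × (Fin br → Fin nr → Euc d)} (hF : ∀ j, LSmooth (fun y => F y (ω.1 j)) L)
    (hω : ∀ j i, ‖ω.2 j i‖ = 1) :
    ‖RGE F μr nr br x ω - linearRGE (fun j => gradient (fun y => F y (ω.1 j)) x) ω.2‖
      ≤ d * L * μr / 2 :=
  norm_average_sub_average_le hbr fun j => norm_average_sub_average_le hnr fun i =>
    norm_finiteDifference_sub_le hμr (hF j) x (hω j i)

/-- Second moment of a square integrable random vector with coordinatewise bounded variance. -/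
lemma integral_norm_sq_le_of_coordinate_variance_le {d : ℕ} {Ω : Type*} [MeasurableSpace Ω]
    {P : Measure Ω} [IsProbabilityMeasure P] {g : Ω → Euc d} (hg : MemLp g 2 P) {s : ℝ}
    (hvar : ∀ i, ∫ ω, (g ω i - (∫ ω, g ω ∂P) i) ^ 2 ∂P ≤ s) :
    ∫ ω, ‖g ω‖ ^ 2 ∂P ≤ ‖∫ ω, g ω ∂P‖ ^ 2 + d * s := by
  have hcoord : ∀ i, ∫ ω, g ω i ^ 2 ∂P ≤ (∫ ω, g ω ∂P) i ^ 2 + s := fun i => by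
    have hi := hvar i
    have hgi := hg.euc_apply i
    have h1 := ProbabilityTheory.variance_eq_sub hgi
    rw [ProbabilityTheory.variance_eq_integral hgi.aemeasurable] at h1
    rw [integral_euc_apply (hg.integrable (by norm_num)) i] at hi ⊢
    simp only [Pi.pow_apply] at h1
    linarith
  rw [integral_norm_sq_eq_sum hg, EuclideanSpace.real_norm_sq_eq]
  refine (Finset.sum_le_sum fun i _ => hcoord i).trans ?_
  rw [Finset.sum_add_distrib]
  simp

lemma measurable_linearRGE_comp {d : ℕ} {Ω : Type*} [MeasurableSpace Ω] {nr br : ℕ}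
    {g : Ω → Euc d} (hg : Measurable g) :
    Measurable fun ω : (Fin br → Ω) × (Fin br → Fin nr → Euc d) =>
      linearRGE (fun j => g (ω.1 j)) ω.2 := by
  unfold linearRGE
  fun_prop

section RGEmeas

variable {d : ℕ} {Ω : Type} [MeasurableSpace Ω] {P : Measure Ω} [IsProbabilityMeasure P]
  {nr br : ℕ} {g : Ω → Euc d}

instance isProbabilityMeasure_RGEmeas : IsProbabilityMeasure (RGEmeas d P nr br) := by
  unfold RGEmeas
  infer_instance

lemma ae_RGEmeas_of_ae (hd : 1 ≤ d) {p : Ω → Prop} (hp : ∀ᵐ ω ∂P, p ω) :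
    ∀ᵐ ω ∂(RGEmeas d P nr br), (∀ j, p (ω.1 j)) ∧ ∀ j i, ‖ω.2 j i‖ = 1 := by
  have h1 : ∀ᵐ ω ∂(Measure.pi fun _ : Fin br => P), ∀ j, p (ω j) :=
    Filter.eventually_all.2 fun j => Measure.tendsto_eval_ae_ae.eventually hp
  have h2 : ∀ᵐ w ∂(Measure.pi fun _ : Fin br => Measure.pi fun _ : Fin nr => sphereUniform d),
      ∀ j i, ‖w j i‖ = 1 :=
    Filter.eventually_all.2 fun j => Measure.tendsto_eval_ae_ae.eventually
      (p := fun w : Fin nr → Euc d => ∀ i, ‖w i‖ = 1) <|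
      Filter.eventually_all.2 fun i =>
        (Measure.tendsto_eval_ae_ae (μ := fun _ : Fin nr => sphereUniform d) (i := i)).eventually
          (ae_norm_eq_one_sphereUniform hd)
  exact (Measure.quasiMeasurePreserving_fst.ae h1).and (Measure.quasiMeasurePreserving_snd.ae h2)

lemma memLp_of_integrable_norm_sq_linearRGE (hd : 1 ≤ d) (hnr : 1 ≤ nr) (hbr : 1 ≤ br)
    (hg : Measurable g)
    (h : Integrable (fun ω => ‖linearRGE (fun j => g (ω.1 j)) ω.2‖ ^ 2) (RGEmeas d P nr br)) :
    MemLp g 2 P := by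
  have hint := h.integral_prod_left
  simp only [integral_norm_sq_linearRGE hd hnr] at hint
  have hbr' : (br : ℝ) ≠ 0 := by positivity
  have hmeas : Measurable fun ω : Fin br → Ω => ∑ j, g (ω j) := by fun_prop
  refine memLp_of_memLp_sum_pi hbr (by norm_num) (by norm_num)
    ((memLp_two_iff_integrable_sq_norm hmeas.aestronglyMeasurable).2 ?_)
  refine (hint.const_mul ((br : ℝ) ^ 2)).mono' (hmeas.norm.pow_const 2).aestronglyMeasurable
    (Filter.Eventually.of_forall fun ω => ?_)
  have hd' : (1 : ℝ) ≤ d := by exact_mod_cast hd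
  have hnn : 0 ≤ ((d : ℝ) - 1) / nr * ∑ j, ‖g (ω j)‖ ^ 2 :=
    mul_nonneg (div_nonneg (by linarith) (by positivity)) (by positivity)
  rw [Real.norm_of_nonneg (by positivity), ← mul_assoc, ← mul_pow, mul_inv_cancel₀ hbr']
  linarith

lemma integral_norm_sq_linearRGE_comp (hd : 1 ≤ d) (hnr : 1 ≤ nr) (hbr : 1 ≤ br)
    (hg : MemLp g 2 P)
    (h : Integrable (fun ω => ‖linearRGE (fun j => g (ω.1 j)) ω.2‖ ^ 2) (RGEmeas d P nr br)) :
    ∫ ω, ‖linearRGE (fun j => g (ω.1 j)) ω.2‖ ^ 2 ∂(RGEmeas d P nr br)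
      = (1 - (br : ℝ)⁻¹) * ‖∫ ω, g ω ∂P‖ ^ 2
        + (br : ℝ)⁻¹ * (1 + (d - 1) / nr) * ∫ ω, ‖g ω‖ ^ 2 ∂P := by
  have hbr' : (br : ℝ) ≠ 0 := by positivity
  have hk : ∀ j, MemLp (fun ω : Fin br → Ω => g (ω j)) 2 (Measure.pi fun _ => P) := fun j =>
    hg.comp_measurePreserving (measurePreserving_eval (fun _ : Fin br => P) j)
  have hsq : ∀ j, Integrable (fun ω : Fin br → Ω => ‖g (ω j)‖ ^ 2) (Measure.pi fun _ => P) :=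
    fun j => (hk j).integrable_norm_pow (by norm_num)
  have hsum : Integrable (fun ω : Fin br → Ω => ‖∑ j, g (ω j)‖ ^ 2) (Measure.pi fun _ => P) :=
    (memLp_finsetSum Finset.univ fun j _ => hk j).integrable_norm_pow (by norm_num)
  have heval : ∀ j : Fin br, ∫ ω : Fin br → Ω, ‖g (ω j)‖ ^ 2 ∂(Measure.pi fun _ => P)
      = ∫ y, ‖g y‖ ^ 2 ∂P := fun j =>
    integral_comp_eval (μ := fun _ : Fin br => P) (i := j) (hg.1.norm.pow 2)
  rw [RGEmeas, integral_prod _ h]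
  simp only [integral_norm_sq_linearRGE hd hnr]
  rw [integral_const_mul, integral_add hsum ((integrable_finsetSum _ fun j _ => hsq j).const_mul _),
    integral_const_mul, integral_finsetSum _ fun j _ => hsq j,
    integral_norm_sq_sum_pi (μ := fun _ : Fin br => P) (T := fun _ => g) fun _ => hg,
    Finset.sum_congr rfl fun j _ => heval j]
  simp only [Finset.sum_const, Finset.card_univ, Fintype.card_fin, nsmul_eq_mul]
  rw [← Nat.cast_smul_eq_nsmul ℝ, norm_smul, Real.norm_natCast]
  field_simp
  ring

end RGEmeas

/-- Combination of the linearization error and the second moment of the linear part. -/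
lemma second_moment_bound_of_le {I S N V L μr : ℝ} {d nr br : ℕ} (hd : 1 ≤ d) (hN : 0 ≤ N)
    (hV : 0 ≤ V) (hS : S ≤ N + V)
    (hI : I ≤ 2 * ((1 - (br : ℝ)⁻¹) * N + (br : ℝ)⁻¹ * (1 + (d - 1) / nr) * S)
      + 2 * (d * L * μr / 2) ^ 2) :
    I ≤ (2 + (4 / (br : ℝ)) * (1 + (d : ℝ) / (nr : ℝ))) * N
        + (4 * V / (br : ℝ)) * (1 + (d : ℝ) / (nr : ℝ))
        + (1 + 2 / (br : ℝ) + 2 / ((nr : ℝ) * (br : ℝ)))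
          * (μr ^ 2 * L ^ 2 * (d : ℝ) ^ 2 / 2) := by
  have hd' : (1 : ℝ) ≤ d := by exact_mod_cast hd
  have hratio0 : 0 ≤ ((d : ℝ) - 1) / nr := div_nonneg (by linarith) (by positivity)
  have hcoef : (br : ℝ)⁻¹ * (1 + ((d : ℝ) - 1) / nr) * S
      ≤ (br : ℝ)⁻¹ * (1 + (d : ℝ) / nr) * (N + V) := by
    calc _ ≤ (br : ℝ)⁻¹ * (1 + ((d : ℝ) - 1) / nr) * (N + V) := by gcongr
      _ ≤ _ := by gcongr; linarith
  have hNb : 0 ≤ (br : ℝ)⁻¹ * N := by positivity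
  have hpos : 0 ≤ (br : ℝ)⁻¹ * (1 + (d : ℝ) / nr) * (N + V) := by positivity
  have hq : 0 ≤ (2 / (br : ℝ) + 2 / ((nr : ℝ) * br)) * (μr ^ 2 * L ^ 2 * (d : ℝ) ^ 2 / 2) := by
    positivity
  calc I ≤ _ := hI
    _ ≤ 2 * N + 4 * ((br : ℝ)⁻¹ * (1 + (d : ℝ) / nr) * (N + V))
        + (μr ^ 2 * L ^ 2 * (d : ℝ) ^ 2 / 2
          + (2 / (br : ℝ) + 2 / ((nr : ℝ) * br)) * (μr ^ 2 * L ^ 2 * (d : ℝ) ^ 2 / 2)) := by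
      linarith
    _ = _ := by ring

/-- **Proposition 4, bound III: second moment of the RGE.** -/
theorem rge_second_moment_bound
    (d : ℕ) (hd : 1 ≤ d)
    {Ω : Type} [MeasurableSpace Ω] (P : Measure Ω) [IsProbabilityMeasure P]
    (L ζ : ℝ) (hL : 0 ≤ L) (hζ : 0 ≤ ζ)
    (F : Euc d → Ω → ℝ)
    (hFmeas : Measurable (Function.uncurry F))
    (hFsmooth : ∀ᵐ ω ∂P, LSmooth (fun x => F x ω) L)
    (f : Euc d → ℝ) (hfdef : ∀ x, f x = ∫ ω, F x ω ∂P)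
    (hfsmooth : LSmooth f L)
    (hgradf : ∀ x, gradient f x = ∫ ω, gradient (fun y => F y ω) x ∂P)
    (hvar : ∀ (x : Euc d) (i : Fin d),
      ∫ ω, (gradient (fun y => F y ω) x i - gradient f x i) ^ 2 ∂P ≤ ζ ^ 2)
    (μr : ℝ) (hμr : 0 < μr) (nr br : ℕ) (hnr : 1 ≤ nr) (hbr : 1 ≤ br)
    (x : Euc d) :
    ∫ ω, ‖RGE F μr nr br x ω‖ ^ 2 ∂(RGEmeas d P nr br)
      ≤ (2 + (4 / (br : ℝ)) * (1 + (d : ℝ) / (nr : ℝ))) * ‖gradient f x‖ ^ 2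
        + (4 * ((d : ℝ) * ζ ^ 2) / (br : ℝ)) * (1 + (d : ℝ) / (nr : ℝ))
        + (1 + 2 / (br : ℝ) + 2 / ((nr : ℝ) * (br : ℝ))) * (μr ^ 2 * L ^ 2 * (d : ℝ) ^ 2 / 2) := by
  have hdiff : ∀ᵐ ω ∂P, DifferentiableAt ℝ (fun y => F y ω) x := hFsmooth.mono fun _ h => h.1 x
  have hgrad := aemeasurable_gradient_of_measurable
    (fun y => hFmeas.comp measurable_prodMk_left) hdiff
  set g := hgrad.mk
  have hgm : Measurable g := hgrad.measurable_mk
  have hgeq : ∀ᵐ ω ∂P, gradient (fun y => F y ω) x = g ω := hgrad.ae_eq_mk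
  have hclose : ∀ᵐ ω ∂(RGEmeas d P nr br),
      ‖RGE F μr nr br x ω - linearRGE (fun j => g (ω.1 j)) ω.2‖ ≤ d * L * μr / 2 := by
    filter_upwards [ae_RGEmeas_of_ae hd (hFsmooth.and hgeq)] with ω hω
    simpa only [(hω.1 _).2] using
      norm_RGE_sub_linearRGE_le hμr hnr hbr x (fun j => (hω.1 j).1) hω.2
  by_cases hG : Integrable (fun ω => ‖RGE F μr nr br x ω‖ ^ 2) (RGEmeas d P nr br)
  swap
  · rw [integral_undef hG]
    positivity
  have hA : Integrable (fun ω => ‖linearRGE (fun j => g (ω.1 j)) ω.2‖ ^ 2)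
      (RGEmeas d P nr br) := by
    refine ((hG.const_mul 2).add (integrable_const (2 * (d * L * μr / 2) ^ 2))).mono'
      ((measurable_linearRGE_comp hgm).norm.pow_const 2).aestronglyMeasurable ?_
    filter_upwards [hclose] with ω hω
    rw [norm_sub_rev] at hω
    simpa using norm_sq_le_of_norm_sub_le hω
  have hgL2 := memLp_of_integrable_norm_sq_linearRGE hd hnr hbr hgm hA
  have hmean : gradient f x = ∫ ω, g ω ∂P := (hgradf x).trans (integral_congr_ae hgeq)
  have hsecond : ∫ ω, ‖g ω‖ ^ 2 ∂P ≤ ‖gradient f x‖ ^ 2 + d * ζ ^ 2 := by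
    rw [hmean]
    refine integral_norm_sq_le_of_coordinate_variance_le hgL2 fun i => ?_
    rw [← hmean]
    refine (integral_congr_ae ?_).trans_le (hvar x i)
    filter_upwards [hgeq] with ω hω
    rw [hω]
  have hbound : ∫ ω, ‖RGE F μr nr br x ω‖ ^ 2 ∂(RGEmeas d P nr br)
      ≤ 2 * ∫ ω, ‖linearRGE (fun j => g (ω.1 j)) ω.2‖ ^ 2 ∂(RGEmeas d P nr br)
        + 2 * (d * L * μr / 2) ^ 2 := by
    have h := integral_mono_ae hG
      ((hA.const_mul 2).add (integrable_const (2 * (d * L * μr / 2) ^ 2)))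
      (hclose.mono fun ω hω => norm_sq_le_of_norm_sub_le hω)
    simpa [integral_add (hA.const_mul 2) (integrable_const _), integral_const_mul] using h
  rw [integral_norm_sq_linearRGE_comp hd hnr hbr hgL2 hA, ← hmean] at hbound
  exact second_moment_bound_of_le hd (sq_nonneg _) (by positivity) hsecond hbound
end
end
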